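/- Let n ≥ 6 and let G be a graph in 𝒢 of the form G^{(+)}_{n,r,s} with 2 ≤ r ≤ s. (a) If r = 2 and either G = G_{n,2,s} with s ≥ 4 or G = G⁺_{n,2,s} with s ≥ 3, then G has exactly two maximal subdividable sets of edges: the edge set of the spine v_1v_2…v_n and the edge set of the second spine v_{n−2}v_{n−3}…v_2v_1v_{n−1}v_n. (b) If r ≥ 3, then the only maximal subdividable set of edges of G is the edge set of the spine v_1v_2…v_n. -/

import Mathlib

namespace K24Paper

open SimpleGraph

/-- `H` is a minor of `G`: branch sets indexed by vertices of `H`, pairwise disjoint,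
each inducing a connected subgraph of `G`, with every edge of `H` realized by an edge
of `G` between the corresponding branch sets. -/
def IsMinor {W V : Type*} (H : SimpleGraph W) (G : SimpleGraph V) : Prop :=
  ∃ B : W → Set V,
    (∀ w, (G.induce (B w)).Connected) ∧
    (∀ w₁ w₂, w₁ ≠ w₂ → Disjoint (B w₁) (B w₂)) ∧
    (∀ w₁ w₂, H.Adj w₁ w₂ → ∃ v₁ ∈ B w₁, ∃ v₂ ∈ B w₂, G.Adj v₁ v₂)

/-- `G` is `H`-minor-free. -/
def MinorFree {W V : Type*} (H : SimpleGraph W) (G : SimpleGraph V) : Prop :=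
  ¬ IsMinor H G

/-- The complete bipartite graph `K_{2,4}`. -/
def K24 : SimpleGraph (Fin 2 ⊕ Fin 4) := completeBipartiteGraph (Fin 2) (Fin 4)

/-- `G` is `k`-connected: more than `k` vertices, and removing fewer than `k`
vertices leaves a connected graph. -/
def KConnected {V : Type*} (k : ℕ) (G : SimpleGraph V) : Prop :=
  k < Nat.card V ∧ ∀ S : Set V, S.ncard < k → (G.induce Sᶜ).Connected

/-- The graph `G_{n,r,s}` (with the plus edge if `plus = true`), on vertices
`0, …, n-1` corresponding to `v_1, …, v_n`:  the spine `v_1 v_2 ⋯ v_n`, the edges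
`v_1 v_{n-i}` for `1 ≤ i ≤ r`, the edges `v_n v_{1+j}` for `1 ≤ j ≤ s`, and
(if `plus`) the plus edge `v_1 v_n`. -/
def Gnrs (n r s : ℕ) (plus : Bool) : SimpleGraph (Fin n) :=
  SimpleGraph.fromRel (fun a b =>
    b.val = a.val + 1 ∨
    (a.val = 0 ∧ n - 1 - r ≤ b.val ∧ b.val ≤ n - 2) ∨
    (b.val = n - 1 ∧ 1 ≤ a.val ∧ a.val ≤ s) ∨
    (plus = true ∧ a.val = 0 ∧ b.val = n - 1))

/-- The parameter conditions describing membership in the class `𝒢`. -/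
def Gparams (n r s : ℕ) (plus : Bool) : Prop :=
  (plus = true ∧ 4 ≤ n ∧ ((r = 1 ∧ s = n - 3) ∨ (r = n - 3 ∧ s = 1))) ∨
  (5 ≤ n ∧ 2 ≤ r ∧ r ≤ n - 3 ∧ 2 ≤ s ∧ s ≤ n - 3 ∧ (r + s = n - 2 ∨ r + s = n - 1))

/-- `G` belongs to `𝒢̃`, i.e. `G` is isomorphic to a graph of the class `𝒢`. -/
def InGtilde {V : Type*} (G : SimpleGraph V) : Prop :=
  ∃ n r s plus, Gparams n r s plus ∧ Nonempty (G ≃g Gnrs n r s plus)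

/-- The graph obtained from `G` by subdividing every edge in `F` once:
new vertices are the members of `F`. -/
def SubdivideEdges {V : Type*} (G : SimpleGraph V) (F : Set (Sym2 V)) :
    SimpleGraph (V ⊕ F) :=
  SimpleGraph.fromRel (fun a b =>
    match a, b with
    | Sum.inl u, Sum.inl v => G.Adj u v ∧ s(u, v) ∉ F
    | Sum.inl u, Sum.inr e => u ∈ (e : Sym2 V)
    | Sum.inr e, Sum.inl u => u ∈ (e : Sym2 V)
    | Sum.inr _, Sum.inr _ => False)

/-- A set `F` of edges of a graph `G` is subdividable if subdividing every edge
of `F` once yields a `K_{2,4}`-minor-free graph. -/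
def Subdividable {V : Type*} (G : SimpleGraph V) (F : Set (Sym2 V)) : Prop :=
  F ⊆ G.edgeSet ∧ MinorFree K24 (SubdivideEdges G F)

/-- `F` is a maximal subdividable set of edges of `G`. -/
def MaxSubdividable {V : Type*} (G : SimpleGraph V) (F : Set (Sym2 V)) : Prop :=
  Subdividable G F ∧ ∀ F', Subdividable G F' → F ⊆ F' → F' = F

/-- `l` lists vertices along a path of `G` (consecutive entries adjacent, no repeats)
such that no two edges of `G` cross with respect to this ordering. -/
def OuterListing {U : Type*} (G : SimpleGraph U) (l : List U) : Prop :=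
  l.Nodup ∧ l.Chain' G.Adj ∧
  ∀ (i k j m : ℕ) (h1 : i < k) (h2 : k < j) (h3 : j < m) (hm : m < l.length),
    ¬(G.Adj (l.get ⟨i, by omega⟩) (l.get ⟨j, by omega⟩) ∧
      G.Adj (l.get ⟨k, by omega⟩) (l.get ⟨m, by omega⟩))

/-- The graph `G` restricted to the vertex set `A` is `xy`-outerplanar: it has a
hamilton `xy`-path (listing exactly the vertices of `A`) such that no two edges
cross with respect to it. -/
def XYOuterplanar {U : Type*} (G : SimpleGraph U) (A : Set U) (x y : U) : Prop :=
  ∃ l : List U, (∀ v, v ∈ l ↔ v ∈ A) ∧ l.head? = some x ∧ l.getLast? = some y ∧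
    OuterListing G l

/-- A block: a connected graph with no cutvertex. -/
def IsBlock {V : Type*} (G : SimpleGraph V) : Prop :=
  G.Connected ∧ ∀ v : V, (G.induce {u | u ≠ v}).Preconnected

/-- `G + xy`: the graph `G` with the edge `xy` added (if not already present). -/
def AddEdge {U : Type*} (G : SimpleGraph U) (x y : U) : SimpleGraph U :=
  G ⊔ SimpleGraph.fromRel (fun a b => a = x ∧ b = y)

/-- A standard `K_{2,t}` minor `(R₁, R₂; S)` of `G`. -/
def StdK2tMinor {V : Type*} (G : SimpleGraph V) (t : ℕ) (R₁ R₂ S : Set V) : Prop :=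
  Disjoint R₁ R₂ ∧ Disjoint (R₁ ∪ R₂) S ∧
  (G.induce R₁).Connected ∧ (G.induce R₂).Connected ∧
  S.Finite ∧ S.ncard = t ∧
  ∀ v ∈ S, (∃ w ∈ R₁, G.Adj v w) ∧ (∃ w ∈ R₂, G.Adj v w)

/-- `K_{3,3}` with parts `{0,1,2}` and `{3,4,5}`. -/
def K33 : SimpleGraph (Fin 6) :=
  SimpleGraph.fromRel (fun a b => a.val < 3 ∧ 3 ≤ b.val)

/-- The graph `A = K_{3,3} + v₂v₃`. -/
def GA : SimpleGraph (Fin 6) := AddEdge K33 1 2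

/-- The graph `A⁺ = K_{3,3} + v₂v₃ + v₅v₆`. -/
def GAplus : SimpleGraph (Fin 6) := AddEdge GA 4 5

/-- The graph `B`, on vertices `h, r₁, r₂, r₃, r₄, g₁, g₂ = 0, …, 6`. -/
def GB : SimpleGraph (Fin 7) :=
  SimpleGraph.fromRel (fun a b => (a.val, b.val) ∈
    [(0,3),(0,4),(1,4),(2,3),(3,4),(5,0),(5,1),(5,2),(6,0),(6,1),(6,2)])

/-- The graph `B⁺ = B + g₁g₂`. -/
def GBplus : SimpleGraph (Fin 7) := AddEdge GB 5 6

/-- The graph `C⁺`, on vertices `v₁, …, v₈ = 0, …, 7`. -/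
def GCplus : SimpleGraph (Fin 8) :=
  SimpleGraph.fromRel (fun a b => (a.val, b.val) ∈
    [(0,1),(0,2),(1,2),(3,4),(3,5),(3,6),(3,7),(4,5),(4,6),(4,7),(2,5),(1,7),(0,6)])

/-- The graph `C = C⁺ ∖ v₄v₅`. -/
def GC : SimpleGraph (Fin 8) := GCplus.deleteEdges {s(3, 4)}

/-- The graph `D`, on vertices `t₁, t₂, t₃, d₁, d₂, d₃, g = 0, …, 6`. -/
def GD : SimpleGraph (Fin 7) :=
  SimpleGraph.fromRel (fun a b => (a.val, b.val) ∈
    [(0,1),(0,2),(1,2),(3,4),(3,5),(4,5),(0,3),(1,4),(2,5),(6,0),(6,1),(6,2)])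

/-- The complete graph `K₅`. -/
def GK5 : SimpleGraph (Fin 5) := completeGraph (Fin 5)

end K24Paper

namespace K24Paper

/-- The edge set of the spine `v₁v₂⋯vₙ` of `G^{(+)}_{n,r,s}`. -/
def SpineSet (n : ℕ) : Set (Sym2 (Fin n)) :=
  {e | ∃ i j : Fin n, j.val = i.val + 1 ∧ e = s(i, j)}

/-- The edge set of the second spine `v_{n-2}v_{n-3}⋯v₂v₁v_{n-1}vₙ` of
`G^{(+)}_{n,2,s}`. -/
def SecondSpineSet (n : ℕ) : Set (Sym2 (Fin n)) :=
  {e | (∃ i j : Fin n, j.val = i.val + 1 ∧ j.val ≤ n - 3 ∧ e = s(i, j)) ∨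
       (∃ i j : Fin n, i.val = 0 ∧ j.val = n - 2 ∧ e = s(i, j)) ∨
       (∃ i j : Fin n, i.val = n - 2 ∧ j.val = n - 1 ∧ e = s(i, j))}

/-- The host graph on `ℕ`: a path `0, …, N`, with `0` joined to everything from `m` on
and `N` joined to everything up to `m`. -/
def Hg (N m : ℕ) : SimpleGraph ℕ :=
  SimpleGraph.fromRel (fun a b => (b = a + 1 ∧ b ≤ N) ∨ (a = 0 ∧ m ≤ b ∧ b ≤ N) ∨ (b = N ∧ a ≤ m))

lemma Hg_adj {N m a b : ℕ} (h : (Hg N m).Adj a b) :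
    a ≠ b ∧ ((b = a + 1 ∧ b ≤ N) ∨ (a = b + 1 ∧ a ≤ N) ∨ (a = 0 ∧ m ≤ b ∧ b ≤ N) ∨
      (b = 0 ∧ m ≤ a ∧ a ≤ N) ∨ (b = N ∧ a ≤ m) ∨ (a = N ∧ b ≤ m)) := by
  simp only [Hg, SimpleGraph.fromRel_adj] at h
  tauto

/-- Induction along a connected induced subgraph. -/
lemma conn_induct {V : Type*} {G : SimpleGraph V} {B : Set V} (hB : (G.induce B).Connected)
    (P : V → Prop) {a : V} (ha : a ∈ B) (h0 : P a)
    (hs : ∀ x y, x ∈ B → y ∈ B → G.Adj x y → P x → P y) : ∀ b ∈ B, P b := by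
  intro b hb
  obtain ⟨w⟩ := hB.preconnected ⟨a, ha⟩ ⟨b, hb⟩
  have key : ∀ (u v : B) (_ : (G.induce B).Walk u v), P u.1 → P v.1 := by
    intro u v w
    induction w with
    | nil => exact id
    | cons h _ ih => exact fun hu => ih (hs _ _ (Subtype.property _) (Subtype.property _) h hu)
  exact key _ _ w h0

def Free (N : ℕ) (I : Set ℕ) : Prop := 0 ∉ I ∧ N ∉ I

def Ivl (I : Set ℕ) : Prop := ∀ x ∈ I, ∀ y ∈ I, ∀ z, x ≤ z → z ≤ y → z ∈ I

lemma ivl_of_conn {N m : ℕ} {I : Set ℕ} (hI : ((Hg N m).induce I).Connected) (hf : Free N I) :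
    Ivl I := by
  intro x hx y hy z hxz hzy
  by_contra hz
  have hxz' : x < z := lt_of_le_of_ne hxz (fun h => hz (h ▸ hx))
  have := conn_induct hI (fun t => t < z) hx hxz' (by
    intro a b ha hb hab haz
    have h1 : a ≠ 0 := fun h => hf.1 (h ▸ ha)
    have h2 : b ≠ 0 := fun h => hf.1 (h ▸ hb)
    have h3 : a ≠ N := fun h => hf.2 (h ▸ ha)
    have h4 : b ≠ N := fun h => hf.2 (h ▸ hb)
    have h5 : b ≠ z := fun h => hz (h ▸ hb)
    have := Hg_adj hab
    show b < z
    omega) y hy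
  have h7 : y < z := this
  omega

def Up (I J : Set ℕ) : Prop := ∃ x ∈ I, x + 1 ∈ J

def Nbr (N m : ℕ) (I J : Set ℕ) : Prop := ∃ x ∈ I, ∃ y ∈ J, (Hg N m).Adj x y

lemma Nbr.symm {N m : ℕ} {I J : Set ℕ} (h : Nbr N m I J) : Nbr N m J I := by
  obtain ⟨x, hx, y, hy, h⟩ := h
  exact ⟨y, hy, x, hx, h.symm⟩

lemma up_of_nbr {N m : ℕ} {I J : Set ℕ} (hI : Free N I) (hJ : Free N J) (h : Nbr N m I J) :
    Up I J ∨ Up J I := by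
  obtain ⟨a, ha, b, hb, hab⟩ := h
  have h1 : a ≠ 0 := fun h => hI.1 (h ▸ ha)
  have h2 : b ≠ 0 := fun h => hJ.1 (h ▸ hb)
  have h3 : a ≠ N := fun h => hI.2 (h ▸ ha)
  have h4 : b ≠ N := fun h => hJ.2 (h ▸ hb)
  have := Hg_adj hab
  have : b = a + 1 ∨ a = b + 1 := by omega
  rcases this with h | h
  · exact Or.inl ⟨a, ha, h ▸ hb⟩
  · exact Or.inr ⟨b, hb, h ▸ ha⟩

lemma dj {I J : Set ℕ} (h : Disjoint I J) {x : ℕ} (hx : x ∈ I) (hy : x ∈ J) : False :=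
  Set.disjoint_left.1 h hx hy

lemma ivl_lt {I J : Set ℕ} (hI : Ivl I) (hJ : Ivl J) (hd : Disjoint I J) {a b : ℕ}
    (ha : a ∈ I) (hb : b ∈ J) (hab : a < b) : ∀ x ∈ I, ∀ y ∈ J, x < y := by
  intro x hx y hy
  by_contra hxy
  by_cases h : y ≤ a
  · exact dj hd ha (hJ y hy b hb a h hab.le)
  · exact dj hd (hI a ha x hx y (by omega) (by omega)) hy

lemma same_up {I J K : Set ℕ} (hI : Ivl I) (hJ : Disjoint I J) (hK : Disjoint I K)
    (hJK : Disjoint J K) (h1 : Up I J) (h2 : Up I K) : False := by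
  obtain ⟨x, hx, hx'⟩ := h1
  obtain ⟨y, hy, hy'⟩ := h2
  rcases lt_trichotomy x y with h | h | h
  · exact dj hJ (hI x hx y hy (x+1) (by omega) (by omega)) hx'
  · subst h; exact dj hJK hx' hy'
  · exact dj hK (hI y hy x hx (y+1) (by omega) (by omega)) hy'

lemma same_down {I J K : Set ℕ} (hI : Ivl I) (hJ : Disjoint I J) (hK : Disjoint I K)
    (hJK : Disjoint J K) (h1 : Up J I) (h2 : Up K I) : False := by
  obtain ⟨x, hx, hx'⟩ := h1
  obtain ⟨y, hy, hy'⟩ := h2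
  rcases lt_trichotomy x y with h | h | h
  · exact dj hK (hI _ hx' _ hy' y (by omega) (by omega)) hy
  · subst h; exact dj hJK hx hy
  · exact dj hJ (hI _ hy' _ hx' x (by omega) (by omega)) hx

lemma deg3 {N m : ℕ} {I J K L : Set ℕ} (hI : Ivl I) (fI : Free N I) (fJ : Free N J)
    (fK : Free N K) (fL : Free N L) (dJ : Disjoint I J) (dK : Disjoint I K) (dL : Disjoint I L)
    (dJK : Disjoint J K) (dJL : Disjoint J L) (dKL : Disjoint K L)
    (nJ : Nbr N m I J) (nK : Nbr N m I K) (nL : Nbr N m I L) : False := by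
  have u := same_up hI dJ dK dJK
  have v := same_up hI dJ dL dJL
  have w := same_up hI dK dL dKL
  have u' := same_down hI dJ dK dJK
  have v' := same_down hI dJ dL dJL
  have w' := same_down hI dK dL dKL
  have a := up_of_nbr fI fJ nJ
  have b := up_of_nbr fI fK nK
  have c := up_of_nbr fI fL nL
  tauto

lemma up_lt {I J : Set ℕ} (hI : Ivl I) (hJ : Ivl J) (hd : Disjoint I J) (h : Up I J) :
    ∀ x ∈ I, ∀ y ∈ J, x < y := by
  obtain ⟨x, hx, hx'⟩ := h
  exact ivl_lt hI hJ hd hx hx' (by omega)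

lemma cyc {I J K L : Set ℕ} (hI : Ivl I) (hJ : Ivl J) (hK : Ivl K) (hL : Ivl L)
    (dIJ : Disjoint I J) (dJK : Disjoint J K) (dKL : Disjoint K L) (dLI : Disjoint L I)
    (h1 : Up I J) (h2 : Up J K) (h3 : Up K L) (h4 : Up L I) : False := by
  have l1 := up_lt hI hJ dIJ h1
  have l2 := up_lt hJ hK dJK h2
  have l3 := up_lt hK hL dKL h3
  have l4 := up_lt hL hI dLI h4
  obtain ⟨i, hi, hj⟩ := h1
  obtain ⟨k, hk, hl⟩ := h3
  have := l1 i hi _ hj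
  have := l2 _ hj k hk
  have := l3 k hk _ hl
  have := l4 _ hl i hi
  omega

lemma c4 {N m : ℕ} {I J K L : Set ℕ} (hI : Ivl I) (hJ : Ivl J) (hK : Ivl K) (hL : Ivl L)
    (fI : Free N I) (fJ : Free N J) (fK : Free N K) (fL : Free N L)
    (dIJ : Disjoint I J) (dIK : Disjoint I K) (dIL : Disjoint I L)
    (dJK : Disjoint J K) (dJL : Disjoint J L) (dKL : Disjoint K L)
    (nIJ : Nbr N m I J) (nJK : Nbr N m J K) (nKL : Nbr N m K L) (nLI : Nbr N m L I) : False := by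
  have a := up_of_nbr fI fJ nIJ
  have b := up_of_nbr fJ fK nJK
  have c := up_of_nbr fK fL nKL
  have d := up_of_nbr fL fI nLI
  have uI := same_up hI dIJ dIL dJL
  have vI := same_down hI dIJ dIL dJL
  have uJ := same_up hJ dIJ.symm dJK dIK
  have vJ := same_down hJ dIJ.symm dJK dIK
  have uK := same_up hK dJK.symm dKL dJL
  have vK := same_down hK dJK.symm dKL dJL
  have e := cyc hI hJ hK hL dIJ dJK dKL dIL.symm
  have f := cyc hL hK hJ hI dKL.symm dJK.symm dIJ.symm dIL
  rcases a with a | a <;> rcases b with b | b <;> rcases c with c | c <;> rcases d with d | d <;>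
    first
    | exact uI a d | exact vI a d | exact uJ a b | exact vJ a b | exact uK b c | exact vK b c
    | exact e a b c d | exact f c b a d

/-- Structure of a connected set containing `0` but not `N`. -/
lemma runX {N m : ℕ} {X : Set ℕ} (hX : ((Hg N m).induce X).Connected) (h0 : 0 ∈ X) (hN : N ∉ X) :
    ∀ x ∈ X, x = 0 ∨ (∀ y, 1 ≤ y → y ≤ x → y ∈ X) ∨
      ∃ z, m ≤ z ∧ ∀ y, min x z ≤ y → y ≤ max x z → y ∈ X := by
  refine conn_induct hX _ h0 (Or.inl rfl) ?_
  intro a b ha hb hab h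
  have h3 : a ≠ N := fun h => hN (h ▸ ha)
  have h4 : b ≠ N := fun h => hN (h ▸ hb)
  have hh := Hg_adj hab
  by_cases hb0 : b = 0
  · exact Or.inl hb0
  right
  by_cases hb1 : b = 1
  · left; intro y h1 h2
    have : y = b := by omega
    exact this ▸ hb
  by_cases hbm : m ≤ b
  · right; refine ⟨b, hbm, fun y h1 h2 => ?_⟩
    have : y = b := by omega
    exact this ▸ hb
  have ha0 : a ≠ 0 := by omega
  rcases h with h | h | ⟨z, hz, h⟩
  · exact absurd h ha0
  · left; intro y h1 h2
    by_cases hy : y = b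
    · exact hy ▸ hb
    · exact h y h1 (by omega)
  · right; refine ⟨z, hz, fun y h1 h2 => ?_⟩
    by_cases hy : y = b
    · exact hy ▸ hb
    · exact h y (by omega) (by omega)

lemma runY {N m : ℕ} {Y : Set ℕ} (hY : ((Hg N m).induce Y).Connected) (h0 : 0 ∉ Y) (hN : N ∈ Y) :
    ∀ x ∈ Y, x = N ∨ (∀ y, x ≤ y → y + 1 ≤ N → y ∈ Y) ∨
      ∃ z, z ≤ m ∧ ∀ y, min x z ≤ y → y ≤ max x z → y ∈ Y := by
  refine conn_induct hY _ hN (Or.inl rfl) ?_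
  intro a b ha hb hab h
  have h3 : a ≠ 0 := fun h => h0 (h ▸ ha)
  have h4 : b ≠ 0 := fun h => h0 (h ▸ hb)
  have hh := Hg_adj hab
  by_cases hb0 : b = N
  · exact Or.inl hb0
  right
  by_cases hb1 : b + 1 = N
  · left; intro y h1 h2
    have : y = b := by omega
    exact this ▸ hb
  by_cases hbm : b ≤ m
  · right; refine ⟨b, hbm, fun y h1 h2 => ?_⟩
    have : y = b := by omega
    exact this ▸ hb
  have ha0 : a ≠ N := by omega
  rcases h with h | h | ⟨z, hz, h⟩
  · exact absurd h ha0
  · left; intro y h1 h2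
    by_cases hy : y = b
    · exact hy ▸ hb
    · exact h y (by omega) h2
  · right; refine ⟨z, hz, fun y h1 h2 => ?_⟩
    by_cases hy : y = b
    · exact hy ▸ hb
    · exact h y (by omega) (by omega)

lemma core {N m : ℕ} {X Y I₁ I₂ I₃ I₄ : Set ℕ}
    (hX : ((Hg N m).induce X).Connected) (hY : ((Hg N m).induce Y).Connected)
    (h0X : 0 ∈ X) (hNX : N ∉ X) (h0Y : 0 ∉ Y) (hNY : N ∈ Y) (dXY : Disjoint X Y)
    (i2 : Ivl I₂) (i3 : Ivl I₃)
    (f1 : Free N I₁) (f2 : Free N I₂) (f3 : Free N I₃) (f4 : Free N I₄)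
    (x1 : Disjoint X I₁) (x2 : Disjoint X I₂) (x3 : Disjoint X I₃)
    (y2 : Disjoint Y I₂) (y3 : Disjoint Y I₃) (y4 : Disjoint Y I₄)
    (d23 : Disjoint I₂ I₃)
    {a₁ a₂ a₃ a₄ : ℕ} (h1 : a₁ ∈ I₁) (h2 : a₂ ∈ I₂) (h3 : a₃ ∈ I₃) (h4 : a₄ ∈ I₄)
    (l12 : ∀ x ∈ I₂, a₁ < x) (l23 : a₂ < a₃) (l34 : ∀ x ∈ I₃, x < a₄) (h4N : a₄ ≤ N)
    (n2 : Nbr N m I₂ X) (n3 : Nbr N m I₃ Y) : False := by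
  have lt23 := ivl_lt i2 i3 d23 h2 h3 l23
  have ha1 : a₁ ≠ 0 := fun h => f1.1 (h ▸ h1)
  have ha4 : a₄ ≠ N := fun h => f4.2 (h ▸ h4)
  have s1 : (∀ x ∈ I₂, x < m) → m ∈ X ∧ ∀ y ∈ I₃, m < y := by
    intro hlt
    obtain ⟨x, hx, p, hp, hxp⟩ := n2
    have hxm := hlt x hx
    have := l12 x hx
    have hpN : p ≠ N := fun h => hNX (h ▸ hp)
    have hxN : x ≠ N := fun h => f2.2 (h ▸ hx)
    have hh := Hg_adj hxp
    rcases runX hX h0X hNX p hp with h | h | ⟨z, hz, h⟩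
    · omega
    · exact (dj x1 (h a₁ (by omega) (by omega)) h1).elim
    · by_cases hpx : p < x
      · exact (dj x2 (h x (by omega) (by omega)) hx).elim
      · refine ⟨h m (by omega) (by omega), fun y hy => ?_⟩
        by_contra hym
        have := lt23 x hx y hy
        exact dj x3 (h y (by omega) (by omega)) hy
  have s2 : (∀ x ∈ I₃, m < x) → m ∈ Y ∧ ∀ y ∈ I₂, y < m := by
    intro hlt
    obtain ⟨x, hx, p, hp, hxp⟩ := n3
    have hxm := hlt x hx
    have := l34 x hx
    have hpN : p ≠ 0 := fun h => h0Y (h ▸ hp)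
    have hxN : x ≠ 0 := fun h => f3.1 (h ▸ hx)
    have hh := Hg_adj hxp
    rcases runY hY h0Y hNY p hp with h | h | ⟨z, hz, h⟩
    · omega
    · exact (dj y4 (h a₄ (by omega) (by omega)) h4).elim
    · by_cases hpx : x < p
      · exact (dj y3 (h x (by omega) (by omega)) hx).elim
      · refine ⟨h m (by omega) (by omega), fun y hy => ?_⟩
        by_contra hym
        have := lt23 y hy x hx
        exact dj y2 (h y (by omega) (by omega)) hy
  by_cases h : ∀ x ∈ I₂, x < m
  · obtain ⟨c, d⟩ := s1 h
    exact dj dXY c (s2 d).1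
  · push Not at h
    obtain ⟨x, hx, hm⟩ := h
    have := (s2 (fun y hy => lt_of_le_of_lt hm (lt23 x hx y hy))).2 x hx
    omega

lemma core' {N m : ℕ} (hm : m ≤ N) {X Y : Set ℕ} {S : Fin 4 → Set ℕ}
    (hX : ((Hg N m).induce X).Connected) (hY : ((Hg N m).induce Y).Connected)
    (h0X : 0 ∈ X) (hNX : N ∉ X) (h0Y : 0 ∉ Y) (hNY : N ∈ Y) (dXY : Disjoint X Y)
    (i : ∀ j, Ivl (S j)) (f : ∀ j, Free N (S j))
    (x : ∀ j, Disjoint X (S j)) (y : ∀ j, Disjoint Y (S j))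
    (d : ∀ j k, j ≠ k → Disjoint (S j) (S k))
    (nX : ∀ j, Nbr N m (S j) X) (nY : ∀ j, Nbr N m (S j) Y) : False := by
  choose a ha p hp hap using nX
  have ainj : Function.Injective a := by
    intro j k hjk
    by_contra hne
    exact dj (d j k hne) (ha j) (hjk ▸ ha k)
  have hmono := Tuple.monotone_sort a
  set σ := Tuple.sort a with hσ
  have hst : StrictMono (a ∘ σ) :=
    hmono.strictMono_of_injective (ainj.comp σ.injective)
  have hl : ∀ u v : Fin 4, u < v → ∀ s ∈ S (σ u), ∀ t ∈ S (σ v), s < t := fun u v huv =>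
    ivl_lt (i _) (i _) (d _ _ (fun h => huv.ne (σ.injective h))) (ha _) (ha _) (hst huv)
  have hN : ∀ j, a j ≤ N := by
    intro j
    have := Hg_adj (hap j)
    omega
  exact core (I₁ := S (σ 0)) (I₂ := S (σ 1)) (I₃ := S (σ 2)) (I₄ := S (σ 3)) hX hY h0X hNX h0Y hNY dXY
    (i _) (i _) (f _) (f _) (f _) (f _) (x _) (x _) (x _) (y _) (y _) (y _)
    (d _ _ (fun h => absurd (σ.injective h) (by decide)))
    (ha (σ 0)) (ha (σ 1)) (ha (σ 2)) (ha (σ 3))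
    (hl 0 1 (by decide) _ (ha _)) (hl 1 2 (by decide) _ (ha _) _ (ha _))
    (fun t ht => hl 2 3 (by decide) t ht _ (ha _)) (hN _)
    ⟨_, ha _, _, hp _, hap _⟩ (nY _)

lemma Hg_minorFree {N m : ℕ} (hm : m ≤ N) : MinorFree K24 (Hg N m) := by
  rintro ⟨B, hc, hd, ha⟩
  have dS : ∀ j k : Fin 4, j ≠ k → Disjoint (B (Sum.inr j)) (B (Sum.inr k)) :=
    fun j k h => hd _ _ (by simpa using h)
  have dR : ∀ i j, Disjoint (B (Sum.inl i)) (B (Sum.inr j)) := fun i j => hd _ _ (by simp)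
  have dRR : ∀ i j : Fin 2, i ≠ j → Disjoint (B (Sum.inl i)) (B (Sum.inl j)) :=
    fun j k h => hd _ _ (by simpa using h)
  have nb : ∀ i j, Nbr N m (B (Sum.inl i)) (B (Sum.inr j)) := fun i j =>
    ha _ _ (by simp [K24, completeBipartiteGraph])
  have iv : ∀ w, Free N (B w) → Ivl (B w) := fun w hw => ivl_of_conn (hc w) hw
  have uniq : ∀ x : ℕ, ∃ j0 : Fin 4, ∀ j, j ≠ j0 → x ∉ B (Sum.inr j) := by
    intro x
    by_cases h : ∃ j, x ∈ B (Sum.inr j)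
    · obtain ⟨j0, hj0⟩ := h
      exact ⟨j0, fun j hj hx => dj (dS j j0 hj) hx hj0⟩
    · push Not at h
      exact ⟨0, fun j _ => h j⟩
  have three : ∀ j0 : Fin 4, ∃ a b c : Fin 4, a ≠ b ∧ a ≠ c ∧ b ≠ c ∧ a ≠ j0 ∧ b ≠ j0 ∧ c ≠ j0 := by
    decide
  have two : ∀ j0 j1 : Fin 4, ∃ a b : Fin 4, a ≠ b ∧ a ≠ j0 ∧ b ≠ j0 ∧ a ≠ j1 ∧ b ≠ j1 := by
    decide
  have nofree : ∀ i i' : Fin 2, i ≠ i' → ¬ Free N (B (Sum.inl i)) := by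
    intro i i' hii hf
    have d3 : ∀ j0, (∀ j, j ≠ j0 → Free N (B (Sum.inr j))) → False := by
      intro j0 hj
      obtain ⟨a, b, c, hab, hac, hbc, h1, h2, h3⟩ := three j0
      exact deg3 (iv _ hf) hf (hj a h1) (hj b h2) (hj c h3) (dR i a) (dR i b) (dR i c)
        (dS _ _ hab) (dS _ _ hac) (dS _ _ hbc) (nb i a) (nb i b) (nb i c)
    obtain ⟨j0, hj0⟩ := uniq 0
    obtain ⟨j1, hj1⟩ := uniq N
    by_cases h0 : 0 ∈ B (Sum.inl i')
    · exact d3 j1 (fun j hj => ⟨fun h => dj (dR i' j) h0 h, hj1 j hj⟩)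
    by_cases hN : N ∈ B (Sum.inl i')
    · exact d3 j0 (fun j hj => ⟨hj0 j hj, fun h => dj (dR i' j) hN h⟩)
    obtain ⟨a, b, hab, h1, h2, h3, h4⟩ := two j0 j1
    have hf' : Free N (B (Sum.inl i')) := ⟨h0, hN⟩
    have fa : Free N (B (Sum.inr a)) := ⟨hj0 a h1, hj1 a h3⟩
    have fb : Free N (B (Sum.inr b)) := ⟨hj0 b h2, hj1 b h4⟩
    exact c4 (iv _ hf) (iv _ fa) (iv _ hf') (iv _ fb) hf fa hf' fb (dR i a) (dRR _ _ hii) (dR i b)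
      (dR i' a).symm (dS _ _ hab) (dR i' b) (nb i a) (nb i' a).symm (nb i' b) (nb i b).symm
  have fin : ∀ i i' : Fin 2, i ≠ i' → 0 ∈ B (Sum.inl i) → N ∈ B (Sum.inl i') → False := by
    intro i i' hii h0 hN
    have fS : ∀ j, Free N (B (Sum.inr j)) := fun j =>
      ⟨fun h => dj (dR i j) h0 h, fun h => dj (dR i' j) hN h⟩
    exact core' hm (hc _) (hc _) h0 (fun h => dj (dRR _ _ hii) h hN) (fun h => dj (dRR _ _ hii) h0 h)
      hN (dRR _ _ hii) (fun j => iv _ (fS j)) fS (dR i) (dR i') dS (fun j => (nb i j).symm)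
      (fun j => (nb i' j).symm)
  have a0 := nofree 0 1 (by decide)
  have a1 := nofree 1 0 (by decide)
  have f0 := fin 0 1 (by decide)
  have f1 := fin 1 0 (by decide)
  have e0 : ∀ x, x ∈ B (Sum.inl 0) → x ∈ B (Sum.inl 1) → False := fun x => dj (dRR 0 1 (by decide))
  have := e0 0
  have := e0 N
  simp only [Free] at a0 a1
  tauto

/-- Minors are preserved by injective homomorphisms. -/
lemma isMinor_of_hom {W V V' : Type*} {H : SimpleGraph W} {G : SimpleGraph V} {G' : SimpleGraph V'}
    (f : V → V') (hf : Function.Injective f) (hom : ∀ a b, G.Adj a b → G'.Adj (f a) (f b))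
    (h : IsMinor H G) : IsMinor H G' := by
  obtain ⟨B, hc, hd, ha⟩ := h
  refine ⟨fun w => f '' B w, fun w => ?_, fun w₁ w₂ hw => (Set.disjoint_image_iff hf).2 (hd _ _ hw), ?_⟩
  · let φ : G.induce (B w) →g G'.induce (f '' B w) :=
      ⟨fun x => ⟨f x.1, x.1, x.2, rfl⟩, fun {a b} hab => hom _ _ hab⟩
    refine (hc w).map φ ?_
    rintro ⟨_, x, hx, rfl⟩
    exact ⟨⟨x, hx⟩, rfl⟩
  · intro w₁ w₂ hw
    obtain ⟨v₁, h₁, v₂, h₂, h⟩ := ha _ _ hw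
    exact ⟨f v₁, ⟨_, h₁, rfl⟩, f v₂, ⟨_, h₂, rfl⟩, hom _ _ h⟩

lemma sub_adj {V : Type*} {G : SimpleGraph V} {F : Set (Sym2 V)} :
    (∀ u v, (SubdivideEdges G F).Adj (Sum.inl u) (Sum.inl v) ↔ G.Adj u v ∧ s(u, v) ∉ F) ∧
    (∀ u (e : F), (SubdivideEdges G F).Adj (Sum.inl u) (Sum.inr e) ↔ u ∈ (e : Sym2 V)) ∧
    (∀ u (e : F), (SubdivideEdges G F).Adj (Sum.inr e) (Sum.inl u) ↔ u ∈ (e : Sym2 V)) ∧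
    (∀ (e e' : F), ¬ (SubdivideEdges G F).Adj (Sum.inr e) (Sum.inr e')) := by
  refine ⟨fun u v => ?_, fun u e => ?_, fun u e => ?_, fun e e' => ?_⟩
  · simp only [SubdivideEdges, SimpleGraph.fromRel_adj]
    constructor
    · rintro ⟨_, h | h⟩
      · exact h
      · exact ⟨h.1.symm, by rw [Sym2.eq_swap]; exact h.2⟩
    · intro h
      exact ⟨fun hh => h.1.ne (Sum.inl_injective hh), Or.inl h⟩
  · simp [SubdivideEdges, SimpleGraph.fromRel_adj]
  · simp [SubdivideEdges, SimpleGraph.fromRel_adj]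
  · simp [SubdivideEdges, SimpleGraph.fromRel_adj]

def esum {V : Type*} (π : V → ℕ) (e : Sym2 V) : ℕ :=
  Sym2.lift ⟨fun a b => π a + π b, fun _ _ => Nat.add_comm _ _⟩ e

lemma esum_mk {V : Type*} (π : V → ℕ) (a b : V) : esum π s(a, b) = π a + π b := rfl

lemma order_minorFree {n k : ℕ} (hk : k + 1 ≤ n) (G : SimpleGraph (Fin n)) (F : Set (Sym2 (Fin n)))
    (π : Fin n → ℕ) (hinj : Function.Injective π) (hlt : ∀ a, π a < n)
    (hadj : ∀ a b, G.Adj a b → s(a, b) ∉ F →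
      (π a = 0 ∧ k ≤ π b) ∨ (π b = 0 ∧ k ≤ π a) ∨ (π b = n - 1 ∧ π a ≤ k) ∨
      (π a = n - 1 ∧ π b ≤ k))
    (hF : ∀ e ∈ F, ∃ a b, π b = π a + 1 ∧ e = s(a, b)) :
    MinorFree K24 (SubdivideEdges G F) := by
  intro hmin
  obtain ⟨A1, A2, A3, A4⟩ := @sub_adj _ G F
  let pos : (Fin n ⊕ F) → ℕ := Sum.elim (fun a => 2 * π a) (fun e => esum π e.1)
  have hpl : ∀ a, pos (Sum.inl a) = 2 * π a := fun a => rfl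
  have hpr : ∀ e, pos (Sum.inr e) = esum π e.1 := fun a => rfl
  have hodd : ∀ e : F, ∃ a b, π b = π a + 1 ∧ e.1 = s(a, b) ∧ esum π e.1 = 2 * π a + 1 := by
    intro e
    obtain ⟨a, b, h, he⟩ := hF e.1 e.2
    refine ⟨a, b, h, he, ?_⟩
    rw [he, esum_mk]; omega
  have mixed : ∀ u (e : F), u ∈ e.1 → (Hg (2 * (n - 1)) (2 * k)).Adj (2 * π u) (esum π e.1) := by
    intro u e hu
    obtain ⟨a, b, h, he, h2⟩ := hodd e
    rw [he, Sym2.mem_iff] at hu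
    have := hlt b
    rw [h2]
    simp only [Hg, SimpleGraph.fromRel_adj]
    rcases hu with rfl | rfl
    · refine ⟨by omega, Or.inl (Or.inl ⟨by omega, by omega⟩)⟩
    · refine ⟨by omega, Or.inr (Or.inl ⟨by omega, by omega⟩)⟩
  refine Hg_minorFree (N := 2 * (n - 1)) (m := 2 * k) (by omega) (isMinor_of_hom pos ?_ ?_ hmin)
  · rintro (a | e) (b | e') h
    · rw [hpl, hpl] at h
      rw [hinj (by omega : π a = π b)]
    · obtain ⟨_, _, _, _, h2⟩ := hodd e'
      rw [hpl, hpr] at h; omega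
    · obtain ⟨_, _, _, _, h2⟩ := hodd e
      rw [hpl, hpr] at h; omega
    · obtain ⟨a, b, hab, he, h2⟩ := hodd e
      obtain ⟨a', b', hab', he', h2'⟩ := hodd e'
      rw [hpr, hpr] at h
      have h1 : a = a' := hinj (by omega)
      have h3 : b = b' := hinj (by omega)
      subst h1 h3
      rw [Subtype.ext (he.trans he'.symm)]
  · rintro (a | e) (b | e') h
    · rw [A1] at h
      have h1 := hadj a b h.1 h.2
      have hne : π a ≠ π b := fun hh => h.1.ne (hinj hh)
      have := hlt a
      have := hlt b
      simp only [hpl, Hg, SimpleGraph.fromRel_adj]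
      refine ⟨by omega, ?_⟩
      rcases h1 with h1 | h1 | h1 | h1
      · exact Or.inl (Or.inr (Or.inl (by omega)))
      · exact Or.inr (Or.inr (Or.inl (by omega)))
      · exact Or.inl (Or.inr (Or.inr (by omega)))
      · exact Or.inr (Or.inr (Or.inr (by omega)))
    · rw [A2] at h; exact mixed _ _ h
    · rw [A3] at h; exact (mixed _ _ h).symm
    · exact (A4 _ _ h).elim

/-- Arithmetic form of adjacency in `Gnrs`. -/
def NA (n r s : ℕ) (plus : Bool) (a b : ℕ) : Prop :=
  b = a + 1 ∨ a = b + 1 ∨ (a = 0 ∧ n - 1 - r ≤ b ∧ b ≤ n - 2) ∨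
  (b = 0 ∧ n - 1 - r ≤ a ∧ a ≤ n - 2) ∨ (b = n - 1 ∧ 1 ≤ a ∧ a ≤ s) ∨
  (a = n - 1 ∧ 1 ≤ b ∧ b ≤ s) ∨ (plus = true ∧ a = 0 ∧ b = n - 1) ∨ (plus = true ∧ b = 0 ∧ a = n - 1)

lemma Gnrs_adj {n r s : ℕ} {plus : Bool} {a b : Fin n} :
    (Gnrs n r s plus).Adj a b ↔ a.val ≠ b.val ∧ NA n r s plus a b := by
  simp only [Gnrs, SimpleGraph.fromRel_adj, NA, ne_eq, Fin.ext_iff]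
  refine and_congr_right fun _ => ⟨?_, ?_⟩
  · rintro ((h | h | h | h) | (h | h | h | h))
    · exact Or.inl h
    · exact Or.inr (Or.inr (Or.inl h))
    · exact Or.inr (Or.inr (Or.inr (Or.inr (Or.inl h))))
    · exact Or.inr (Or.inr (Or.inr (Or.inr (Or.inr (Or.inr (Or.inl h))))))
    · exact Or.inr (Or.inl h)
    · exact Or.inr (Or.inr (Or.inr (Or.inl h)))
    · exact Or.inr (Or.inr (Or.inr (Or.inr (Or.inr (Or.inl h)))))
    · exact Or.inr (Or.inr (Or.inr (Or.inr (Or.inr (Or.inr (Or.inr h))))))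
  · rintro (h | h | h | h | h | h | h | h)
    · exact Or.inl (Or.inl h)
    · exact Or.inr (Or.inl h)
    · exact Or.inl (Or.inr (Or.inl h))
    · exact Or.inr (Or.inr (Or.inl h))
    · exact Or.inl (Or.inr (Or.inr (Or.inl h)))
    · exact Or.inr (Or.inr (Or.inr (Or.inl h)))
    · exact Or.inl (Or.inr (Or.inr (Or.inr h)))
    · exact Or.inr (Or.inr (Or.inr (Or.inr h)))

lemma spine_subdividable {n r s : ℕ} {plus : Bool} (hn : 6 ≤ n) (hr : 2 ≤ r) (hs : 2 ≤ s)
    (h : r + s ≤ n - 1) : Subdividable (Gnrs n r s plus) (SpineSet n) := by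
  refine ⟨?_, order_minorFree (k := s) (by omega) _ _ (fun a => a.val) Fin.val_injective
    (fun a => a.2) ?_ ?_⟩
  · rintro _ ⟨i, j, hij, rfl⟩
    rw [SimpleGraph.mem_edgeSet, Gnrs_adj]
    exact ⟨by omega, Or.inl hij⟩
  · intro a b hab hF
    rw [Gnrs_adj] at hab
    have h1 : b.val ≠ a.val + 1 := fun hh => hF ⟨a, b, hh, rfl⟩
    have h2 : a.val ≠ b.val + 1 := fun hh => hF ⟨b, a, hh, Sym2.eq_swap⟩
    obtain ⟨_, hab⟩ := hab
    unfold NA at hab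
    show (a.val = 0 ∧ s ≤ b.val) ∨ (b.val = 0 ∧ s ≤ a.val) ∨ (b.val = n - 1 ∧ a.val ≤ s) ∨
      (a.val = n - 1 ∧ b.val ≤ s)
    omega
  · rintro _ ⟨i, j, hij, rfl⟩
    exact ⟨i, j, hij, rfl⟩

/-- Position along the second spine. -/
def pos2 (n v : ℕ) : ℕ := if v ≤ n - 3 then n - 3 - v else v

lemma second_subdividable {n s : ℕ} {plus : Bool} (hn : 6 ≤ n) (hs : 2 ≤ s)
    (h : 2 + s ≤ n - 1) : Subdividable (Gnrs n 2 s plus) (SecondSpineSet n) := by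
  refine ⟨?_, order_minorFree (k := n - 3) (by omega) _ _ (fun a => pos2 n a.val) ?_ ?_ ?_ ?_⟩
  · rintro _ (⟨i, j, h1, h2, rfl⟩ | ⟨i, j, h1, h2, rfl⟩ | ⟨i, j, h1, h2, rfl⟩) <;>
    · rw [SimpleGraph.mem_edgeSet, Gnrs_adj]
      refine ⟨by omega, ?_⟩
      unfold NA; omega
  · intro a b hab
    have hab : pos2 n a = pos2 n b := hab
    have := a.2
    have := b.2
    apply Fin.ext
    unfold pos2 at hab
    split_ifs at hab <;> omega
  · intro a
    have := a.2
    show pos2 n a < n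
    unfold pos2
    split_ifs <;> omega
  · intro a b hab hF
    rw [Gnrs_adj] at hab
    have h1 : ¬ (b.val = a.val + 1 ∧ b.val ≤ n - 3) := fun hh => hF (Or.inl ⟨a, b, hh.1, hh.2, rfl⟩)
    have h2 : ¬ (a.val = b.val + 1 ∧ a.val ≤ n - 3) := fun hh =>
      hF (Or.inl ⟨b, a, hh.1, hh.2, Sym2.eq_swap⟩)
    have h3 : ¬ (a.val = 0 ∧ b.val = n - 2) := fun hh =>
      hF (Or.inr (Or.inl ⟨a, b, hh.1, hh.2, rfl⟩))
    have h4 : ¬ (b.val = 0 ∧ a.val = n - 2) := fun hh =>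
      hF (Or.inr (Or.inl ⟨b, a, hh.1, hh.2, Sym2.eq_swap⟩))
    have h5 : ¬ (a.val = n - 2 ∧ b.val = n - 1) := fun hh =>
      hF (Or.inr (Or.inr ⟨a, b, hh.1, hh.2, rfl⟩))
    have h6 : ¬ (b.val = n - 2 ∧ a.val = n - 1) := fun hh =>
      hF (Or.inr (Or.inr ⟨b, a, hh.1, hh.2, Sym2.eq_swap⟩))
    obtain ⟨_, hab⟩ := hab
    unfold NA at hab
    have := a.2
    have := b.2
    show (pos2 n a = 0 ∧ n - 3 ≤ pos2 n b) ∨ (pos2 n b = 0 ∧ n - 3 ≤ pos2 n a) ∨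
      (pos2 n b = n - 1 ∧ pos2 n a ≤ n - 3) ∨ (pos2 n a = n - 1 ∧ pos2 n b ≤ n - 3)
    have key : (a.val = 0 ∧ b.val = n - 3) ∨ (b.val = 0 ∧ a.val = n - 3) ∨
        (a.val = n - 3 ∧ b.val = n - 2) ∨ (b.val = n - 3 ∧ a.val = n - 2) ∨
        (b.val = n - 1 ∧ a.val ≤ n - 3) ∨ (a.val = n - 1 ∧ b.val ≤ n - 3) := by
      rcases hab with hab | hab | hab | hab | hab | hab | hab | hab
      · exact Or.inr (Or.inr (Or.inl (by omega)))
      · exact Or.inr (Or.inr (Or.inr (Or.inl (by omega))))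
      · exact Or.inl (by omega)
      · exact Or.inr (Or.inl (by omega))
      · exact Or.inr (Or.inr (Or.inr (Or.inr (Or.inl (by omega)))))
      · exact Or.inr (Or.inr (Or.inr (Or.inr (Or.inr (by omega)))))
      · exact Or.inr (Or.inr (Or.inr (Or.inr (Or.inl (by omega)))))
      · exact Or.inr (Or.inr (Or.inr (Or.inr (Or.inr (by omega)))))
    clear hab h1 h2 h3 h4 h5 h6
    unfold pos2
    rcases key with hab | hab | hab | hab | hab | hab
    · exact Or.inr (Or.inl (by split_ifs <;> omega))
    · exact Or.inl (by split_ifs <;> omega)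
    · exact Or.inl (by split_ifs <;> omega)
    · exact Or.inr (Or.inl (by split_ifs <;> omega))
    · exact Or.inr (Or.inr (Or.inl (by split_ifs <;> omega)))
    · exact Or.inr (Or.inr (Or.inr (by split_ifs <;> omega)))
  · rintro _ (⟨i, j, h1, h2, rfl⟩ | ⟨i, j, h1, h2, rfl⟩ | ⟨i, j, h1, h2, rfl⟩)
    · refine ⟨j, i, ?_, Sym2.eq_swap⟩
      show pos2 n i = pos2 n j + 1
      unfold pos2
      split_ifs <;> omega
    · refine ⟨i, j, ?_, rfl⟩
      show pos2 n j = pos2 n i + 1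
      unfold pos2
      split_ifs <;> omega
    · refine ⟨i, j, ?_, rfl⟩
      show pos2 n j = pos2 n i + 1
      unfold pos2
      split_ifs <;> omega

/-- The label class `k` is nonempty and connected in `G`, witnessed by a root and a rank. -/
def VC {V : Type*} (G : SimpleGraph V) (ℓ : V → ℕ) (k : ℕ) : Prop :=
  ∃ (rk : V → ℕ) (root : V), ℓ root = k ∧
    ∀ v, ℓ v = k → v = root ∨ ∃ v', G.Adj v v' ∧ ℓ v' = k ∧ rk v' < rk v

/-- The label classes `j` and `k` are adjacent. -/
def NB {V : Type*} (G : SimpleGraph V) (ℓ : V → ℕ) (j k : ℕ) : Prop :=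
  ∃ u v, ℓ u = j ∧ ℓ v = k ∧ G.Adj u v

open Classical in
/-- Extension of a vertex labelling to subdivision vertices. -/
noncomputable def lab {V : Type*} (F : Set (Sym2 V)) (ℓ : V → ℕ) (e₁ e₂ : Sym2 V) : V ⊕ F → ℕ
  | Sum.inl v => ℓ v
  | Sum.inr f => if f.1 = e₁ then 2 else if f.1 = e₂ then 3 else ℓ f.1.out.1

lemma lab_edge {V : Type*} {F : Set (Sym2 V)} {ℓ : V → ℕ} {e₁ e₂ : Sym2 V} {u v : V}
    (h : s(u, v) ∈ F) (h1 : s(u, v) ≠ e₁) (h2 : s(u, v) ≠ e₂) :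
    lab F ℓ e₁ e₂ (Sum.inr ⟨_, h⟩) = ℓ u ∨ lab F ℓ e₁ e₂ (Sum.inr ⟨_, h⟩) = ℓ v := by
  simp only [lab, h1, h2, if_false]
  rcases Sym2.mem_iff.1 (Sym2.out_fst_mem s(u, v)) with h | h
  · left; rw [h]
  · right; rw [h]

lemma conn_of_VC {V : Type*} {G : SimpleGraph V} {F : Set (Sym2 V)} {ℓ : V → ℕ} {e₁ e₂ : Sym2 V}
    {k : ℕ} (h : VC G ℓ k)
    (hs1 : ∀ u v, s(u, v) = e₁ → ℓ u ≠ ℓ v) (hs2 : ∀ u v, s(u, v) = e₂ → ℓ u ≠ ℓ v)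
    (hk2 : k ≠ 2) (hk3 : k ≠ 3 ∨ e₁ = e₂) :
    ((SubdivideEdges G F).induce {x | lab F ℓ e₁ e₂ x = k}).Connected := by
  obtain ⟨A1, A2, A3, A4⟩ := @sub_adj _ G F
  obtain ⟨rk, root, hroot, hd⟩ := h
  rw [SimpleGraph.connected_iff_exists_forall_reachable]
  refine ⟨⟨Sum.inl root, hroot⟩, ?_⟩
  have hv : ∀ (m : ℕ) (v : V) (hv : ℓ v = k), rk v = m →
      ((SubdivideEdges G F).induce {x | lab F ℓ e₁ e₂ x = k}).Reachable
        ⟨Sum.inl root, hroot⟩ ⟨Sum.inl v, hv⟩ := by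
    intro m
    induction m using Nat.strong_induction_on with
    | _ m ih =>
      intro v hv hm
      rcases hd v hv with rfl | ⟨v', hadj, hv', hlt⟩
      · exact SimpleGraph.Reachable.refl _
      · have r1 := ih (rk v') (hm ▸ hlt) v' hv' rfl
        refine r1.trans ?_
        by_cases hF : s(v', v) ∈ F
        · have hne1 : s(v', v) ≠ e₁ := fun h => hs1 _ _ h (hv'.trans hv.symm)
          have hne2 : s(v', v) ≠ e₂ := fun h => hs2 _ _ h (hv'.trans hv.symm)
          have hl : lab F ℓ e₁ e₂ (Sum.inr ⟨_, hF⟩) = k := by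
            rcases lab_edge (ℓ := ℓ) hF hne1 hne2 with h | h
            · exact h.trans hv'
            · exact h.trans hv
          have q1 : ((SubdivideEdges G F).induce {x | lab F ℓ e₁ e₂ x = k}).Adj
              ⟨Sum.inl v', hv'⟩ ⟨Sum.inr ⟨_, hF⟩, hl⟩ := by
            exact (A2 _ _).2 (by simp)
          have q2 : ((SubdivideEdges G F).induce {x | lab F ℓ e₁ e₂ x = k}).Adj
              ⟨Sum.inr ⟨_, hF⟩, hl⟩ ⟨Sum.inl v, hv⟩ := by
            exact (A3 _ _).2 (by simp)
          exact q1.reachable.trans q2.reachable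
        · have q1 : ((SubdivideEdges G F).induce {x | lab F ℓ e₁ e₂ x = k}).Adj
              ⟨Sum.inl v', hv'⟩ ⟨Sum.inl v, hv⟩ := by
            exact (A1 _ _).2 ⟨hadj.symm, hF⟩
          exact q1.reachable
  rintro ⟨v | f, hx⟩
  · exact hv _ v hx rfl
  · have hx' : lab F ℓ e₁ e₂ (Sum.inr f) = k := hx
    have hout : ℓ f.1.out.1 = k := by
      simp only [lab] at hx'
      split_ifs at hx' with c1 c2
      · exact absurd hx'.symm hk2
      · rcases hk3 with h | h
        · exact absurd hx'.symm h
        · exact absurd (c2.trans h.symm) c1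
      · exact hx'
    refine (hv _ _ hout rfl).trans ?_
    have q : ((SubdivideEdges G F).induce {x | lab F ℓ e₁ e₂ x = k}).Adj
        ⟨Sum.inl f.1.out.1, hout⟩ ⟨Sum.inr f, hx⟩ := by
      exact (A2 _ _).2 (Sym2.out_fst_mem _)
    exact q.reachable

lemma nbr_of_NB {V : Type*} {G : SimpleGraph V} {F : Set (Sym2 V)} {ℓ : V → ℕ} {e₁ e₂ : Sym2 V}
    {j k : ℕ} (h : NB G ℓ j k) (hk : 2 ≤ k)
    (hs1 : ∀ u v, s(u, v) = e₁ → ℓ u < 2 ∧ ℓ v < 2) (hs2 : ∀ u v, s(u, v) = e₂ → ℓ u < 2 ∧ ℓ v < 2) :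
    ∃ x, lab F ℓ e₁ e₂ x = j ∧ ∃ y, lab F ℓ e₁ e₂ y = k ∧ (SubdivideEdges G F).Adj x y := by
  obtain ⟨A1, A2, A3, A4⟩ := @sub_adj _ G F
  obtain ⟨u, v, hu, hv, hadj⟩ := h
  by_cases hF : s(u, v) ∈ F
  · have hne1 : s(u, v) ≠ e₁ := fun h => by have := hs1 _ _ h; omega
    have hne2 : s(u, v) ≠ e₂ := fun h => by have := hs2 _ _ h; omega
    rcases lab_edge (ℓ := ℓ) hF hne1 hne2 with h | h
    · exact ⟨Sum.inr ⟨_, hF⟩, h.trans hu, Sum.inl v, hv, by rw [A3]; simp⟩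
    · exact ⟨Sum.inl u, hu, Sum.inr ⟨_, hF⟩, h.trans hv, by rw [A2]; simp⟩
  · exact ⟨Sum.inl u, hu, Sum.inl v, hv, by rw [A1]; exact ⟨hadj, hF⟩⟩

lemma conn_single {V : Type*} {G : SimpleGraph V} {B : Set V} {x : V} (hx : x ∈ B)
    (h : ∀ y ∈ B, y = x) : (G.induce B).Connected := by
  rw [SimpleGraph.connected_iff_exists_forall_reachable]
  refine ⟨⟨x, hx⟩, ?_⟩
  rintro ⟨y, hy⟩
  obtain rfl := h y hy
  exact SimpleGraph.Reachable.refl _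

lemma minor_of_labels {V : Type*} {G : SimpleGraph V} {F : Set (Sym2 V)} (ℓ : V → ℕ)
    {a₁ b₁ a₂ b₂ : V} (h1 : s(a₁, b₁) ∈ F) (h2 : s(a₂, b₂) ∈ F)
    (ha1 : ℓ a₁ = 0) (hb1 : ℓ b₁ = 1) (ha2 : ℓ a₂ = 0) (hb2 : ℓ b₂ = 1)
    (n2 : ∀ v, ℓ v ≠ 2) (v0 : VC G ℓ 0) (v1 : VC G ℓ 1) (v4 : VC G ℓ 4) (v5 : VC G ℓ 5)
    (n04 : NB G ℓ 0 4) (n14 : NB G ℓ 1 4) (n05 : NB G ℓ 0 5) (n15 : NB G ℓ 1 5)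
    (h3 : (s(a₁, b₁) ≠ s(a₂, b₂) ∧ ∀ v, ℓ v ≠ 3) ∨
      (s(a₁, b₁) = s(a₂, b₂) ∧ VC G ℓ 3 ∧ NB G ℓ 0 3 ∧ NB G ℓ 1 3)) :
    IsMinor K24 (SubdivideEdges G F) := by
  classical
  obtain ⟨A1, A2, A3, A4⟩ := @sub_adj _ G F
  set e₁ := s(a₁, b₁) with he1
  set e₂ := s(a₂, b₂) with he2
  have t1 : ∀ u v, s(u, v) = e₁ → (ℓ u = 0 ∧ ℓ v = 1) ∨ (ℓ u = 1 ∧ ℓ v = 0) := by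
    intro u v h
    rcases Sym2.eq_iff.1 h with ⟨rfl, rfl⟩ | ⟨rfl, rfl⟩
    · exact Or.inl ⟨ha1, hb1⟩
    · exact Or.inr ⟨hb1, ha1⟩
  have t2 : ∀ u v, s(u, v) = e₂ → (ℓ u = 0 ∧ ℓ v = 1) ∨ (ℓ u = 1 ∧ ℓ v = 0) := by
    intro u v h
    rcases Sym2.eq_iff.1 h with ⟨rfl, rfl⟩ | ⟨rfl, rfl⟩
    · exact Or.inl ⟨ha2, hb2⟩
    · exact Or.inr ⟨hb2, ha2⟩
  have c1 : ∀ u v, s(u, v) = e₁ → ℓ u ≠ ℓ v := fun u v h => by have := t1 u v h; omega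
  have c2 : ∀ u v, s(u, v) = e₂ → ℓ u ≠ ℓ v := fun u v h => by have := t2 u v h; omega
  have d1 : ∀ u v, s(u, v) = e₁ → ℓ u < 2 ∧ ℓ v < 2 := fun u v h => by have := t1 u v h; omega
  have d2 : ∀ u v, s(u, v) = e₂ → ℓ u < 2 ∧ ℓ v < 2 := fun u v h => by have := t2 u v h; omega
  have l1 : lab F ℓ e₁ e₂ (Sum.inr ⟨e₁, h1⟩) = 2 := by simp [lab]
  have l2 : e₁ ≠ e₂ → lab F ℓ e₁ e₂ (Sum.inr ⟨e₂, h2⟩) = 3 := by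
    intro h; simp [lab, h.symm]
  have conn : ∀ k, k < 6 → ((SubdivideEdges G F).induce {x | lab F ℓ e₁ e₂ x = k}).Connected := by
    intro k hk
    by_cases hk2 : k = 2
    · subst hk2
      refine conn_single (x := Sum.inr ⟨e₁, h1⟩) l1 ?_
      rintro (v | f) hy
      · exact absurd hy (n2 v)
      · have hy : lab F ℓ e₁ e₂ (Sum.inr f) = 2 := hy
        simp only [lab] at hy
        split_ifs at hy with g1 g2
        · exact congrArg Sum.inr (Subtype.ext g1)
        · omega
        · exact absurd hy (n2 _)
    by_cases hk3 : k = 3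
    · subst hk3
      rcases h3 with ⟨hne, n3⟩ | ⟨heq, v3, _, _⟩
      · refine conn_single (x := Sum.inr ⟨e₂, h2⟩) (l2 hne) ?_
        rintro (v | f) hy
        · exact absurd hy (n3 v)
        · have hy : lab F ℓ e₁ e₂ (Sum.inr f) = 3 := hy
          simp only [lab] at hy
          split_ifs at hy with g1 g2
          · omega
          · exact congrArg Sum.inr (Subtype.ext g2)
          · exact absurd hy (n3 _)
      · exact conn_of_VC v3 c1 c2 hk2 (Or.inr heq)
    · refine conn_of_VC ?_ c1 c2 hk2 (Or.inl hk3)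
      have : k = 0 ∨ k = 1 ∨ k = 4 ∨ k = 5 := by omega
      rcases this with rfl | rfl | rfl | rfl <;> assumption
  have adj : ∀ j k, j < 2 → 2 ≤ k → k < 6 →
      ∃ x, lab F ℓ e₁ e₂ x = j ∧ ∃ y, lab F ℓ e₁ e₂ y = k ∧ (SubdivideEdges G F).Adj x y := by
    intro j k hj hk hk6
    by_cases hk2 : k = 2
    · subst hk2
      have : j = 0 ∨ j = 1 := by omega
      rcases this with rfl | rfl
      · exact ⟨Sum.inl a₁, ha1, _, l1, by rw [A2]; simp [he1]⟩
      · exact ⟨Sum.inl b₁, hb1, _, l1, by rw [A2]; simp [he1]⟩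
    by_cases hk3 : k = 3
    · subst hk3
      have : j = 0 ∨ j = 1 := by omega
      rcases h3 with ⟨hne, n3⟩ | ⟨heq, _, n03, n13⟩
      · rcases this with rfl | rfl
        · exact ⟨Sum.inl a₂, ha2, _, l2 hne, by rw [A2]; simp [he2]⟩
        · exact ⟨Sum.inl b₂, hb2, _, l2 hne, by rw [A2]; simp [he2]⟩
      · refine nbr_of_NB ?_ hk d1 d2
        rcases this with rfl | rfl <;> assumption
    · refine nbr_of_NB ?_ hk d1 d2
      have h' : j = 0 ∨ j = 1 := by omega
      have : k = 4 ∨ k = 5 := by omega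
      rcases this with rfl | rfl <;> rcases h' with rfl | rfl <;> assumption
  let idx : Fin 2 ⊕ Fin 4 → ℕ := Sum.elim (fun i => i.val) (fun j => j.val + 2)
  have idx6 : ∀ w, idx w < 6 := by
    rintro (i | j)
    · show i.val < 6
      omega
    · show j.val + 2 < 6
      omega
  have idxinj : ∀ w w', idx w = idx w' → w = w' := by
    rintro (i | j) (i' | j') h
    · exact congrArg Sum.inl (Fin.ext h)
    · have h : i.val = j'.val + 2 := h
      omega
    · have h : j.val + 2 = i'.val := h
      omega
    · have h : j.val + 2 = j'.val + 2 := h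
      exact congrArg Sum.inr (Fin.ext (by omega))
  refine ⟨fun w => {x | lab F ℓ e₁ e₂ x = idx w}, fun w => conn _ (idx6 w), ?_, ?_⟩
  · intro w w' hw
    rw [Set.disjoint_left]
    intro x hx hx'
    exact hw (idxinj _ _ (Eq.trans (Eq.symm hx) hx'))
  · rintro (i | j) (i' | j') h
    · simp [K24, completeBipartiteGraph] at h
    · obtain ⟨x, hx, y, hy, hxy⟩ := adj i.val (j'.val + 2) i.2 (by omega) (by omega)
      exact ⟨x, hx, y, hy, hxy⟩
    · obtain ⟨x, hx, y, hy, hxy⟩ := adj i'.val (j.val + 2) i'.2 (by omega) (by omega)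
      exact ⟨y, hy, x, hx, hxy.symm⟩
    · simp [K24, completeBipartiteGraph] at h

/-- A predicate on positions cuts out a nonempty connected set of vertices of `Gnrs`. -/
def CN (n r s : ℕ) (plus : Bool) (P : ℕ → Prop) : Prop :=
  ∃ (rk : ℕ → ℕ) (root : ℕ), root < n ∧ P root ∧
    ∀ v, v < n → P v → v = root ∨ ∃ v', v' < n ∧ v ≠ v' ∧ NA n r s plus v v' ∧ P v' ∧ rk v' < rk v

/-- Two predicates on positions cut out adjacent vertex sets. -/
def NN (n r s : ℕ) (plus : Bool) (P Q : ℕ → Prop) : Prop :=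
  ∃ u v, u < n ∧ v < n ∧ P u ∧ Q v ∧ u ≠ v ∧ NA n r s plus u v

lemma VC_of_CN {n r s : ℕ} {plus : Bool} {P : ℕ → Prop} {ℓ : ℕ → ℕ} {k : ℕ}
    (h : CN n r s plus P) (hl : ∀ v, ℓ v = k ↔ P v) :
    VC (Gnrs n r s plus) (fun v => ℓ v.val) k := by
  obtain ⟨rk, root, hr, hP, h⟩ := h
  refine ⟨fun v => rk v.val, ⟨root, hr⟩, (hl _).2 hP, ?_⟩
  intro v hv
  rcases h v.val v.2 ((hl _).1 hv) with h | ⟨v', h1, h2, h3, h4, h5⟩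
  · exact Or.inl (Fin.ext h)
  · exact Or.inr ⟨⟨v', h1⟩, Gnrs_adj.2 ⟨h2, h3⟩, (hl _).2 h4, h5⟩

lemma NB_of_NN {n r s : ℕ} {plus : Bool} {P Q : ℕ → Prop} {ℓ : ℕ → ℕ} {j k : ℕ}
    (h : NN n r s plus P Q) (hj : ∀ v, ℓ v = j ↔ P v) (hk : ∀ v, ℓ v = k ↔ Q v) :
    NB (Gnrs n r s plus) (fun v => ℓ v.val) j k := by
  obtain ⟨u, v, hu, hv, hP, hQ, hne, h⟩ := h
  exact ⟨⟨u, hu⟩, ⟨v, hv⟩, (hj _).2 hP, (hk _).2 hQ, Gnrs_adj.2 ⟨hne, h⟩⟩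

open Classical in
/-- The labelling defined by five predicates. -/
noncomputable def lab5 (P0 P1 P3 P4 P5 : ℕ → Prop) (v : ℕ) : ℕ :=
  if P0 v then 0 else if P1 v then 1 else if P3 v then 3 else if P4 v then 4 else
    if P5 v then 5 else 6

lemma lab5_spec {P0 P1 P3 P4 P5 : ℕ → Prop}
    (d0 : ∀ v, P0 v → ¬ P1 v ∧ ¬ P3 v ∧ ¬ P4 v ∧ ¬ P5 v)
    (d1 : ∀ v, P1 v → ¬ P3 v ∧ ¬ P4 v ∧ ¬ P5 v)
    (d3 : ∀ v, P3 v → ¬ P4 v ∧ ¬ P5 v) (d4 : ∀ v, P4 v → ¬ P5 v) (v : ℕ) :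
    (lab5 P0 P1 P3 P4 P5 v = 0 ↔ P0 v) ∧ (lab5 P0 P1 P3 P4 P5 v = 1 ↔ P1 v) ∧
    (lab5 P0 P1 P3 P4 P5 v = 3 ↔ P3 v) ∧ (lab5 P0 P1 P3 P4 P5 v = 4 ↔ P4 v) ∧
    (lab5 P0 P1 P3 P4 P5 v = 5 ↔ P5 v) ∧ lab5 P0 P1 P3 P4 P5 v ≠ 2 := by
  have e0 := d0 v
  have e1 := d1 v
  have e3 := d3 v
  have e4 := d4 v
  unfold lab5
  by_cases h0 : P0 v
  · simp [h0, e0 h0]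
  by_cases h1 : P1 v
  · simp [h0, h1, e1 h1]
  by_cases h3 : P3 v
  · simp [h0, h1, h3, e3 h3]
  by_cases h4 : P4 v
  · simp [h0, h1, h3, h4, e4 h4]
  by_cases h5 : P5 v
  · simp [h0, h1, h3, h4, h5]
  · simp [h0, h1, h3, h4, h5]

lemma single_minor {n r s : ℕ} {plus : Bool} {F : Set (Sym2 (Fin n))} {a b : Fin n}
    (he : s(a, b) ∈ F) (P0 P1 P3 P4 P5 : ℕ → Prop) (ha : P0 a.val) (hb : P1 b.val)
    (d0 : ∀ v, P0 v → ¬ P1 v ∧ ¬ P3 v ∧ ¬ P4 v ∧ ¬ P5 v)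
    (d1 : ∀ v, P1 v → ¬ P3 v ∧ ¬ P4 v ∧ ¬ P5 v)
    (d3 : ∀ v, P3 v → ¬ P4 v ∧ ¬ P5 v) (d4 : ∀ v, P4 v → ¬ P5 v)
    (c0 : CN n r s plus P0) (c1 : CN n r s plus P1) (c3 : CN n r s plus P3)
    (c4 : CN n r s plus P4) (c5 : CN n r s plus P5)
    (n03 : NN n r s plus P0 P3) (n13 : NN n r s plus P1 P3)
    (n04 : NN n r s plus P0 P4) (n14 : NN n r s plus P1 P4)
    (n05 : NN n r s plus P0 P5) (n15 : NN n r s plus P1 P5) :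
    IsMinor K24 (SubdivideEdges (Gnrs n r s plus) F) := by
  have sp := lab5_spec d0 d1 d3 d4
  have s0 := fun v => (sp v).1
  have s1 := fun v => (sp v).2.1
  have s3 := fun v => (sp v).2.2.1
  have s4 := fun v => (sp v).2.2.2.1
  have s5 := fun v => (sp v).2.2.2.2.1
  exact minor_of_labels (fun v => lab5 P0 P1 P3 P4 P5 v.val) he he ((s0 _).2 ha) ((s1 _).2 hb)
    ((s0 _).2 ha) ((s1 _).2 hb) (fun v => (sp v.val).2.2.2.2.2) (VC_of_CN c0 s0) (VC_of_CN c1 s1)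
    (VC_of_CN c4 s4) (VC_of_CN c5 s5) (NB_of_NN n04 s0 s4) (NB_of_NN n14 s1 s4)
    (NB_of_NN n05 s0 s5) (NB_of_NN n15 s1 s5)
    (Or.inr ⟨rfl, VC_of_CN c3 s3, NB_of_NN n03 s0 s3, NB_of_NN n13 s1 s3⟩)

lemma CN_single {n r s : ℕ} {plus : Bool} {t : ℕ} (ht : t < n) :
    CN n r s plus (fun v => v = t) :=
  ⟨id, t, ht, rfl, fun _ _ h => Or.inl h⟩

lemma CN_Icc {n r s : ℕ} {plus : Bool} {a b : ℕ} (hab : a ≤ b) (hb : b < n) :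
    CN n r s plus (fun v => a ≤ v ∧ v ≤ b) := by
  refine ⟨id, a, by omega, ⟨le_refl _, hab⟩, fun v _ hv => ?_⟩
  by_cases h : v = a
  · exact Or.inl h
  · exact Or.inr ⟨v - 1, by omega, by omega, Or.inr (Or.inl (by omega)), by omega,
      (show v - 1 < v by omega)⟩

/-- A set all of whose vertices other than the root are adjacent to the root. -/
lemma CN_star {n r s : ℕ} {plus : Bool} {P : ℕ → Prop} (t : ℕ) (ht : t < n) (hP : P t)
    (h : ∀ v, v < n → P v → v ≠ t → NA n r s plus v t) : CN n r s plus P := by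
  refine ⟨fun v => if v = t then 0 else 1, t, ht, hP, fun v hv hPv => ?_⟩
  by_cases hvt : v = t
  · exact Or.inl hvt
  · exact Or.inr ⟨t, ht, hvt, h v hv hPv hvt, hP, by simp [hvt]⟩

section families

variable {n r s : ℕ} {plus : Bool} {F : Set (Sym2 (Fin n))} {a b : Fin n}

lemma famA (he : s(a, b) ∈ F) (hr : 2 ≤ r) (hs : 3 ≤ s) (hs' : s ≤ n - 3) (h : r + s ≤ n - 1)
    (ha : a.val = 0) (hb : n - 1 - r ≤ b.val) (hb' : b.val ≤ n - 3) :
    IsMinor K24 (SubdivideEdges (Gnrs n r s plus) F) := by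
  obtain ⟨x, hx⟩ : ∃ x, x = b.val := ⟨_, rfl⟩
  rw [← hx] at hb hb'
  refine single_minor he (fun v => 0 ≤ v ∧ v ≤ s - 2) (fun v => s ≤ v ∧ v ≤ x)
    (fun v => v = x + 1) (fun v => v = n - 1) (fun v => v = s - 1) (by omega) (by omega)
    (by intro v; omega) (by intro v; omega)
    (by intro v; omega) (by intro v; omega)
    (CN_Icc (by omega) (by omega)) (CN_Icc (by omega) (by omega)) (CN_single (by omega))
    (CN_single (by omega)) (CN_single (by omega))
    ⟨0, x + 1, by omega, by omega, by omega, by omega, by omega, by unfold NA; omega⟩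
    ⟨x, x + 1, by omega, by omega, by omega, by omega, by omega, by unfold NA; omega⟩
    ⟨1, n - 1, by omega, by omega, by omega, by omega, by omega, by unfold NA; omega⟩
    ⟨s, n - 1, by omega, by omega, by omega, by omega, by omega, by unfold NA; omega⟩
    ⟨s - 2, s - 1, by omega, by omega, by omega, by omega, by omega, by unfold NA; omega⟩
    ⟨s, s - 1, by omega, by omega, by omega, by omega, by omega, by unfold NA; omega⟩

lemma famB (he : s(a, b) ∈ F) (hr : 3 ≤ r) (hs : 3 ≤ s) (hn : 6 ≤ n) (h : r + s ≤ n - 1)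
    (h' : n - 2 ≤ r + s) (ha : a.val = 0) (hb : b.val = n - 2) :
    IsMinor K24 (SubdivideEdges (Gnrs n r s plus) F) := by
  refine single_minor he (fun v => v = 0 ∨ (s + 1 ≤ v ∧ v ≤ n - 4)) (fun v => n - 2 ≤ v ∧ v ≤ n - 1)
    (fun v => v = 1) (fun v => v = s) (fun v => v = n - 3) (by omega) (by omega)
    (by intro v; omega) (by intro v; omega)
    (by intro v; omega) (by intro v; omega)
    (CN_star 0 (by omega) (Or.inl rfl) (by intro v; unfold NA; omega))
    (CN_Icc (by omega) (by omega)) (CN_single (by omega))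
    (CN_single (by omega)) (CN_single (by omega))
    ⟨0, 1, by omega, by omega, by omega, by omega, by omega, by unfold NA; omega⟩
    ⟨n - 1, 1, by omega, by omega, by omega, by omega, by omega, by unfold NA; omega⟩
    ?_
    ⟨n - 1, s, by omega, by omega, by omega, by omega, by omega, by unfold NA; omega⟩
    ⟨0, n - 3, by omega, by omega, by omega, by omega, by omega, by unfold NA; omega⟩
    ⟨n - 2, n - 3, by omega, by omega, by omega, by omega, by omega, by unfold NA; omega⟩
  by_cases hc : r + s = n - 1
  · exact ⟨0, s, by omega, by omega, by omega, by omega, by omega, by unfold NA; omega⟩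
  · exact ⟨s + 1, s, by omega, by omega, by omega, by omega, by omega, by unfold NA; omega⟩

lemma famA' (he : s(a, b) ∈ F) (hr : 2 ≤ r) (hs : 2 ≤ s) (hn : 6 ≤ n) (hr' : r ≤ n - 3)
    (h : r + s ≤ n - 1) (hrp : 3 ≤ r ∨ plus = true)
    (ha : a.val = n - 1) (hb : 2 ≤ b.val) (hb' : b.val ≤ s) :
    IsMinor K24 (SubdivideEdges (Gnrs n r s plus) F) := by
  obtain ⟨y, hy⟩ : ∃ x, x = b.val := ⟨_, rfl⟩
  rw [← hy] at hb hb'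
  refine single_minor he (fun v => n + 1 - r ≤ v ∧ v ≤ n - 1) (fun v => y ≤ v ∧ v ≤ n - 1 - r)
    (fun v => v = y - 1) (fun v => v = 0) (fun v => v = n - r) (by omega) (by omega)
    (by intro v; omega) (by intro v; omega)
    (by intro v; omega) (by intro v; omega)
    (CN_Icc (by omega) (by omega)) (CN_Icc (by omega) (by omega)) (CN_single (by omega))
    (CN_single (by omega)) (CN_single (by omega))
    ⟨n - 1, y - 1, by omega, by omega, by omega, by omega, by omega, by unfold NA; omega⟩
    ⟨y, y - 1, by omega, by omega, by omega, by omega, by omega, by unfold NA; omega⟩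
    ?_
    ⟨n - 1 - r, 0, by omega, by omega, by omega, by omega, by omega, by unfold NA; omega⟩
    ⟨n + 1 - r, n - r, by omega, by omega, by omega, by omega, by omega, by unfold NA; omega⟩
    ⟨n - 1 - r, n - r, by omega, by omega, by omega, by omega, by omega, by unfold NA; omega⟩
  rcases hrp with hc | hc
  · exact ⟨n - 2, 0, by omega, by omega, by omega, by omega, by omega, by unfold NA; omega⟩
  · exact ⟨n - 1, 0, by omega, by omega, by omega, by omega, by omega, by
      unfold NA; simp [hc]⟩

lemma famB' (he : s(a, b) ∈ F) (hr : 2 ≤ r) (hs : 3 ≤ s) (hn : 6 ≤ n) (h : r + s ≤ n - 1)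
    (h' : n - 2 ≤ r + s) (ha : a.val = n - 1) (hb : 1 ≤ b.val) (hb' : b.val + 2 ≤ s) :
    IsMinor K24 (SubdivideEdges (Gnrs n r s plus) F) := by
  obtain ⟨y, hy⟩ : ∃ x, x = b.val := ⟨_, rfl⟩
  rw [← hy] at hb hb'
  refine single_minor he (fun v => v = n - 1 ∨ (y + 2 ≤ v ∧ v ≤ n - 2 - r))
    (fun v => 0 ≤ v ∧ v ≤ y)
    (fun v => v = n - 2) (fun v => v = n - 1 - r) (fun v => v = y + 1) (by omega) (by omega)
    (by intro v; omega) (by intro v; omega)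
    (by intro v; omega) (by intro v; omega)
    (CN_star (n - 1) (by omega) (Or.inl rfl) (by intro v; unfold NA; omega))
    (CN_Icc (by omega) (by omega)) (CN_single (by omega))
    (CN_single (by omega)) (CN_single (by omega))
    ⟨n - 1, n - 2, by omega, by omega, by omega, by omega, by omega, by unfold NA; omega⟩
    ⟨0, n - 2, by omega, by omega, by omega, by omega, by omega, by unfold NA; omega⟩
    ?_
    ⟨0, n - 1 - r, by omega, by omega, by omega, by omega, by omega, by unfold NA; omega⟩
    ⟨n - 1, y + 1, by omega, by omega, by omega, by omega, by omega, by unfold NA; omega⟩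
    ⟨y, y + 1, by omega, by omega, by omega, by omega, by omega, by unfold NA; omega⟩
  by_cases hc : r + s = n - 1
  · exact ⟨n - 1, n - 1 - r, by omega, by omega, by omega, by omega, by omega, by unfold NA; omega⟩
  · exact ⟨n - 2 - r, n - 1 - r, by omega, by omega, by omega, by omega, by omega,
      by unfold NA; omega⟩

lemma famC' (he : s(a, b) ∈ F) (hr : 2 ≤ r) (hn : 6 ≤ n) (h : r + s ≤ n - 1)
    (ha : a.val = n - 1) (hb : 3 ≤ b.val) (hb' : b.val ≤ s) :
    IsMinor K24 (SubdivideEdges (Gnrs n r s plus) F) := by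
  obtain ⟨y, hy⟩ : ∃ x, x = b.val := ⟨_, rfl⟩
  rw [← hy] at hb hb'
  refine single_minor he (fun v => v = n - 1) (fun v => v = 0 ∨ (y ≤ v ∧ v ≤ n - 1 - r))
    (fun v => v = n - 2) (fun v => v = y - 1) (fun v => v = 1) (by omega) (by omega)
    (by intro v; omega) (by intro v; omega)
    (by intro v; omega) (by intro v; omega)
    (CN_single (by omega)) ?_ (CN_single (by omega))
    (CN_single (by omega)) (CN_single (by omega))
    ⟨n - 1, n - 2, by omega, by omega, by omega, by omega, by omega, by unfold NA; omega⟩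
    ⟨0, n - 2, by omega, by omega, by omega, by omega, by omega, by unfold NA; omega⟩
    ⟨n - 1, y - 1, by omega, by omega, by omega, by omega, by omega, by unfold NA; omega⟩
    ⟨y, y - 1, by omega, by omega, by omega, by omega, by omega, by unfold NA; omega⟩
    ⟨n - 1, 1, by omega, by omega, by omega, by omega, by omega, by unfold NA; omega⟩
    ⟨0, 1, by omega, by omega, by omega, by omega, by omega, by unfold NA; omega⟩
  refine ⟨fun v => if v = 0 then 0 else n - v, 0, by omega, Or.inl rfl, fun v hv hP => ?_⟩
  by_cases h0 : v = 0
  · exact Or.inl h0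
  right
  by_cases h1 : v = n - 1 - r
  · exact ⟨0, by omega, h0, by unfold NA; omega, Or.inl rfl, by simp [h0]; omega⟩
  · refine ⟨v + 1, by omega, by omega, Or.inl rfl, by omega, ?_⟩
    simp [h0]; omega

lemma famD (he : s(a, b) ∈ F) (hr : 2 ≤ r) (hs : 2 ≤ s) (hn : 6 ≤ n)
    (ha : a.val = 0) (hb : b.val = n - 1) :
    IsMinor K24 (SubdivideEdges (Gnrs n r s plus) F) := by
  exact single_minor he (fun v => v = 0) (fun v => v = n - 1)
    (fun v => v = 1) (fun v => v = n - 2) (fun v => 2 ≤ v ∧ v ≤ n - 3) (by omega) (by omega)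
    (by intro v; omega) (by intro v; omega)
    (by intro v; omega) (by intro v; omega)
    (CN_single (by omega)) (CN_single (by omega)) (CN_single (by omega))
    (CN_single (by omega)) (CN_Icc (by omega) (by omega))
    ⟨0, 1, by omega, by omega, by omega, by omega, by omega, by unfold NA; omega⟩
    ⟨n - 1, 1, by omega, by omega, by omega, by omega, by omega, by unfold NA; omega⟩
    ⟨0, n - 2, by omega, by omega, by omega, by omega, by omega, by unfold NA; omega⟩
    ⟨n - 1, n - 2, by omega, by omega, by omega, by omega, by omega, by unfold NA; omega⟩
    ⟨0, n - 3, by omega, by omega, by omega, by omega, by omega, by unfold NA; omega⟩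
    ⟨n - 1, 2, by omega, by omega, by omega, by omega, by omega, by unfold NA; omega⟩

lemma famE {c : Fin n} (he : s(a, b) ∈ F) (hf : s(c, b) ∈ F) (hr : r = 2) (hn : 6 ≤ n)
    (h : n - 2 ≤ r + s) (ha : a.val = n - 3) (hb : b.val = n - 2) (hc : c.val = 0) :
    IsMinor K24 (SubdivideEdges (Gnrs n r s plus) F) := by
  have sp := lab5_spec (P0 := fun v => v = 0 ∨ v = n - 3) (P1 := fun v => n - 2 ≤ v ∧ v ≤ n - 1)
    (P3 := fun v => v < 0) (P4 := fun v => v = 1) (P5 := fun v => v = n - 4)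
    (by intro v; omega) (by intro v; omega)
    (by intro v; omega) (by intro v; omega)
  have s0 := fun v => (sp v).1
  have s1 := fun v => (sp v).2.1
  have s3 := fun v => (sp v).2.2.1
  have s4 := fun v => (sp v).2.2.2.1
  have s5 := fun v => (sp v).2.2.2.2.1
  refine minor_of_labels (fun v => lab5 _ _ _ _ _ v.val) he hf ((s0 _).2 (by omega))
    ((s1 _).2 (by omega)) ((s0 _).2 (by omega)) ((s1 _).2 (by omega))
    (fun v => (sp v.val).2.2.2.2.2)
    (VC_of_CN (CN_star 0 (by omega) (Or.inl rfl) (by intro v; unfold NA; omega)) s0)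
    (VC_of_CN (CN_Icc (by omega) (by omega)) s1)
    (VC_of_CN (CN_single (by omega)) s4) (VC_of_CN (CN_single (by omega)) s5)
    (NB_of_NN ⟨0, 1, by omega, by omega, by omega, by omega, by omega, by unfold NA; omega⟩ s0 s4)
    (NB_of_NN ⟨n - 1, 1, by omega, by omega, by omega, by omega, by omega, by unfold NA; omega⟩ s1 s4)
    (NB_of_NN ⟨n - 3, n - 4, by omega, by omega, by omega, by omega, by omega,
      by unfold NA; omega⟩ s0 s5)
    (NB_of_NN ⟨n - 1, n - 4, by omega, by omega, by omega, by omega, by omega,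
      by unfold NA; omega⟩ s1 s5)
    (Or.inl ⟨?_, fun v hv => Nat.not_lt_zero _ ((s3 _).1 hv)⟩)
  intro heq
  rcases Sym2.eq_iff.1 heq with ⟨h1, _⟩ | ⟨h1, _⟩
  · have := congrArg Fin.val h1
    omega
  · have := congrArg Fin.val h1
    omega

end families


/-- Away from the one exceptional edge, every non-spine edge lies in no subdividable set. -/
lemma sub_edges {n r s : ℕ} {plus : Bool} (hn : 6 ≤ n) (hr : 2 ≤ r) (hs : 3 ≤ s)
    (hr3 : r ≤ n - 3) (hs3 : s ≤ n - 3) (h1 : r + s ≤ n - 1) (h2 : n - 2 ≤ r + s)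
    (hp : 3 ≤ r ∨ plus = true ∨ 4 ≤ s) {F : Set (Sym2 (Fin n))}
    (hF : Subdividable (Gnrs n r s plus) F) {a b : Fin n} (hab : s(a, b) ∈ F) :
    s(a, b) ∈ SpineSet n ∨
      (r = 2 ∧ ((a.val = 0 ∧ b.val = n - 2) ∨ (b.val = 0 ∧ a.val = n - 2))) := by
  -- edges at the first vertex
  have key0 : ∀ a b : Fin n, s(a, b) ∈ F → a.val = 0 → n - 1 - r ≤ b.val → b.val ≤ n - 2 →
      r = 2 ∧ b.val = n - 2 := by
    intro a b he ha hb hb'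
    by_cases hb3 : b.val ≤ n - 3
    · exact (hF.2 (famA he hr hs hs3 h1 ha hb hb3)).elim
    · by_cases hr' : 3 ≤ r
      · exact (hF.2 (famB he hr' hs hn h1 h2 ha (by omega))).elim
      · exact ⟨by omega, by omega⟩
  -- edges at the last vertex
  have key1 : ∀ a b : Fin n, s(a, b) ∈ F → a.val = n - 1 → 1 ≤ b.val → b.val ≤ s → False := by
    intro a b he ha hb hb'
    by_cases c1 : b.val + 2 ≤ s
    · exact hF.2 (famB' he hr hs hn h1 h2 ha hb c1)
    by_cases c2 : 3 ≤ b.val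
    · exact hF.2 (famC' he hr hn h1 ha c2 hb')
    have : 3 ≤ r ∨ plus = true := by
      rcases hp with hp | hp | hp
      · exact Or.inl hp
      · exact Or.inr hp
      · omega
    exact hF.2 (famA' he hr (by omega) hn hr3 h1 this ha (by omega) hb')
  have key2 : ∀ a b : Fin n, s(a, b) ∈ F → a.val = 0 → b.val = n - 1 → False :=
    fun a b he ha hb => hF.2 (famD he hr (by omega) hn ha hb)
  have hba : s(b, a) ∈ F := by rw [Sym2.eq_swap]; exact hab
  have hadj : (Gnrs n r s plus).Adj a b := (SimpleGraph.mem_edgeSet _).1 (hF.1 hab)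
  obtain ⟨_, h⟩ := Gnrs_adj.1 hadj
  rcases h with h | h | ⟨h, h', h''⟩ | ⟨h, h', h''⟩ | ⟨h, h', h''⟩ | ⟨h, h', h''⟩ |
    ⟨_, h, h'⟩ | ⟨_, h, h'⟩
  · exact Or.inl ⟨a, b, h, rfl⟩
  · exact Or.inl ⟨b, a, h, Sym2.eq_swap⟩
  · obtain ⟨k, k'⟩ := key0 a b hab h h' h''
    exact Or.inr ⟨k, Or.inl ⟨h, k'⟩⟩
  · obtain ⟨k, k'⟩ := key0 b a hba h h' h''
    exact Or.inr ⟨k, Or.inr ⟨h, k'⟩⟩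
  · exact (key1 b a hba h h' h'').elim
  · exact (key1 a b hab h h' h'').elim
  · exact (key2 a b hab h h').elim
  · exact (key2 b a hba h h').elim

lemma sub_dichotomy {n s : ℕ} {plus : Bool} (hn : 6 ≤ n) (hs : 3 ≤ s)
    (hs3 : s ≤ n - 3) (h1 : 2 + s ≤ n - 1) (h2 : n - 2 ≤ 2 + s)
    (hp : plus = true ∨ 4 ≤ s) {F : Set (Sym2 (Fin n))}
    (hF : Subdividable (Gnrs n 2 s plus) F) : F ⊆ SpineSet n ∨ F ⊆ SecondSpineSet n := by
  have key : ∀ e ∈ F, e ∈ SpineSet n ∨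
      e = s((⟨0, by omega⟩ : Fin n), (⟨n - 2, by omega⟩ : Fin n)) := by
    intro e he
    induction e using Sym2.ind with
    | _ a b =>
      rcases sub_edges hn le_rfl hs (by omega) hs3 h1 h2 (Or.inr hp) hF he with
        h | ⟨_, ⟨h, h'⟩ | ⟨h, h'⟩⟩
      · exact Or.inl h
      · right
        have e1 : a = ⟨0, by omega⟩ := Fin.ext h
        have e2 : b = ⟨n - 2, by omega⟩ := Fin.ext h'
        rw [e1, e2]
      · right
        have e1 : b = ⟨0, by omega⟩ := Fin.ext h
        have e2 : a = ⟨n - 2, by omega⟩ := Fin.ext h'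
        rw [e1, e2]
        exact Sym2.eq_swap
  by_cases h0 : s((⟨0, by omega⟩ : Fin n), (⟨n - 2, by omega⟩ : Fin n)) ∈ F
  · right
    intro e he
    rcases key e he with ⟨i, j, hij, rfl⟩ | rfl
    · by_cases c1 : j.val ≤ n - 3
      · exact Or.inl ⟨i, j, hij, c1, rfl⟩
      by_cases c2 : j.val = n - 1
      · exact Or.inr (Or.inr ⟨i, j, by omega, c2, rfl⟩)
      have e2 : j = ⟨n - 2, by omega⟩ := Fin.ext (by simp only; omega)
      rw [← e2] at h0
      exact (hF.2 (famE he h0 rfl hn h2 (by omega) (by omega) rfl)).elim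
    · exact Or.inr (Or.inl ⟨_, _, rfl, rfl, rfl⟩)
  · left
    intro e he
    rcases key e he with h | rfl
    · exact h
    · exact absurd he h0

lemma not_spine_sub_second {n : ℕ} (hn : 6 ≤ n) : ¬ SpineSet n ⊆ SecondSpineSet n := by
  intro h
  have := h (show s((⟨n - 3, by omega⟩ : Fin n), (⟨n - 2, by omega⟩ : Fin n)) ∈ SpineSet n from
    ⟨_, _, by simp only; omega, rfl⟩)
  rcases this with ⟨i, j, h1, h2, h3⟩ | ⟨i, j, h1, h2, h3⟩ | ⟨i, j, h1, h2, h3⟩ <;>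
  · rcases Sym2.eq_iff.1 h3 with ⟨k1, k2⟩ | ⟨k1, k2⟩ <;>
    · have k1 := congrArg Fin.val k1
      have k2 := congrArg Fin.val k2
      simp only at k1 k2
      omega

lemma not_second_sub_spine {n : ℕ} (hn : 6 ≤ n) : ¬ SecondSpineSet n ⊆ SpineSet n := by
  intro h
  obtain ⟨i, j, h1, h3⟩ :=
    h (show s((⟨0, by omega⟩ : Fin n), (⟨n - 2, by omega⟩ : Fin n)) ∈ SecondSpineSet n from
      Or.inr (Or.inl ⟨_, _, rfl, rfl, rfl⟩))
  rcases Sym2.eq_iff.1 h3 with ⟨k1, k2⟩ | ⟨k1, k2⟩ <;>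
  · have k1 := congrArg Fin.val k1
    have k2 := congrArg Fin.val k2
    simp only at k1 k2
    omega

/-- Theorem 20(ii),(iii): let `n ≥ 6` and `G = G^{(+)}_{n,r,s} ∈ 𝒢`
with `2 ≤ r ≤ s`.  (a) If `r = 2` and either `G = G_{n,2,s}` with `s ≥ 4` or
`G = G⁺_{n,2,s}` with `s ≥ 3`, then the maximal subdividable sets of edges of `G` are
exactly the edge sets of the spine and of the second spine.  (b) If `r ≥ 3`, the only
maximal subdividable set of edges of `G` is the edge set of the spine. -/
theorem Gnrs_maxSubdividable (n r s : ℕ) (plus : Bool) (hn : 6 ≤ n)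
    (hr : 2 ≤ r) (hrs : r ≤ s) (hG : Gparams n r s plus) :
    ((r = 2 ∧ ((plus = false ∧ 4 ≤ s) ∨ (plus = true ∧ 3 ≤ s))) →
      ∀ F : Set (Sym2 (Fin n)),
        MaxSubdividable (Gnrs n r s plus) F ↔
          (F = SpineSet n ∨ F = SecondSpineSet n)) ∧
    (3 ≤ r →
      ∀ F : Set (Sym2 (Fin n)),
        MaxSubdividable (Gnrs n r s plus) F ↔ F = SpineSet n) := by

  have hpar : r ≤ n - 3 ∧ s ≤ n - 3 ∧ r + s ≤ n - 1 ∧ n - 2 ≤ r + s := by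
    rcases hG with ⟨_, _, h | h⟩ | ⟨_, _, _, _, _, h⟩
    · omega
    · omega
    · omega
  obtain ⟨hr3, hs3, h1, h2⟩ := hpar
  constructor
  · rintro ⟨rfl, hp⟩ F
    have hs : 3 ≤ s := by
      rcases hp with ⟨_, h⟩ | ⟨_, h⟩ <;> omega
    have hp' : plus = true ∨ 4 ≤ s := by
      rcases hp with ⟨_, h⟩ | ⟨h, _⟩
      · exact Or.inr h
      · exact Or.inl h
    have hsp : Subdividable (Gnrs n 2 s plus) (SpineSet n) :=
      spine_subdividable hn hr (by omega) h1
    have hse : Subdividable (Gnrs n 2 s plus) (SecondSpineSet n) :=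
      second_subdividable hn (by omega) h1
    constructor
    · rintro ⟨hF, hmax⟩
      rcases sub_dichotomy hn hs hs3 h1 h2 hp' hF with h | h
      · exact Or.inl (hmax _ hsp h).symm
      · exact Or.inr (hmax _ hse h).symm
    · rintro (rfl | rfl)
      · refine ⟨hsp, fun F' hF' hsub => ?_⟩
        rcases sub_dichotomy hn hs hs3 h1 h2 hp' hF' with h | h
        · exact Set.Subset.antisymm h hsub
        · exact absurd (hsub.trans h) (not_spine_sub_second hn)
      · refine ⟨hse, fun F' hF' hsub => ?_⟩
        rcases sub_dichotomy hn hs hs3 h1 h2 hp' hF' with h | h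
        · exact absurd (hsub.trans h) (not_second_sub_spine hn)
        · exact Set.Subset.antisymm h hsub
  · intro hr' F
    have hsp : Subdividable (Gnrs n r s plus) (SpineSet n) :=
      spine_subdividable hn hr (by omega) h1
    have key : ∀ F', Subdividable (Gnrs n r s plus) F' → F' ⊆ SpineSet n := by
      intro F' hF' e he
      induction e using Sym2.ind with
      | _ a b =>
        rcases sub_edges hn hr (by omega) hr3 hs3 h1 h2 (Or.inl hr') hF' he with h | ⟨h, _⟩
        · exact h
        · omega
    constructor
    · rintro ⟨hF, hmax⟩
      exact (hmax _ hsp (key F hF)).symm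
    · rintro rfl
      exact ⟨hsp, fun F' hF' hsub => Set.Subset.antisymm (key F' hF') hsub⟩

end K24Paper
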